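/- Let ~fim denote, at each type, the equivalence closure EqvGen of the square-duplication relation I (where I l l' iff there exist xs, ys, zs with l = xs ++ ys ++ zs and l' = xs ++ ys ++ ys ++ zs). For all relations S : α → β → Prop and T : β → γ → Prop whose composition Comp S T is nonempty: if List.Forall₂ S xs us, us ~fim vs, and List.Forall₂ T vs zs, then there exist xs' and zs' with xs ~fim xs', List.Forall₂ (Comp S T) xs' zs', and zs' ~fim zs. (Subdistributivity of the relator for the free idempotent monoid.) -/

import Mathlib

/-- Composition of two relations. -/
def Comp {α β γ : Type*} (S : α → β → Prop) (T : β → γ → Prop) (a : α) (c : γ) : Prop :=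
  ∃ b, S a b ∧ T b c

/-- The square-duplication relation: duplicate a contiguous segment `ys`. -/
def SqDup {α : Type*} (l l' : List α) : Prop :=
  ∃ xs ys zs : List α, l = xs ++ ys ++ zs ∧ l' = xs ++ ys ++ ys ++ zs

open Relation hiding Comp

/-- Duplicate a family of pairwise disjoint contiguous segments simultaneously. -/
inductive ParDup {α : Type*} : List α → List α → Prop
  | nil : ParDup [] []
  | cons (a : α) {u v : List α} : ParDup u v → ParDup (a :: u) (a :: v)
  | dup (b : List α) {u v : List α} : ParDup u v → ParDup (b ++ u) (b ++ b ++ v)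

namespace ParDup

variable {α : Type*}

theorem refl (u : List α) : ParDup u u := by
  induction u with
  | nil => exact nil
  | cons a u ih => exact cons a ih

theorem append {u v u' v' : List α} (h : ParDup u v) (h' : ParDup u' v') :
    ParDup (u ++ u') (v ++ v') := by
  induction h with
  | nil => exact h'
  | cons a _ ih => exact cons a ih
  | dup b _ ih => simpa using dup b ih

theorem double (b : List α) : ParDup b (b ++ b) := by
  simpa using dup b nil

/-- The image of a concatenation splits, unless a duplicated segment straddles the boundary. -/
theorem split {u₁ u₂ w : List α} (h : ParDup (u₁ ++ u₂) w) :
    (∃ w₁ w₂, w = w₁ ++ w₂ ∧ ParDup u₁ w₁ ∧ ParDup u₂ w₂) ∨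
    ∃ p q r s w₁ w₂, u₁ = p ++ q ∧ u₂ = r ++ s ∧ ParDup p w₁ ∧ ParDup s w₂ ∧
      w = w₁ ++ (q ++ r) ++ (q ++ r) ++ w₂ := by
  generalize hu : u₁ ++ u₂ = u at h
  induction h generalizing u₁ with
  | nil =>
    obtain ⟨rfl, rfl⟩ := List.append_eq_nil_iff.1 hu
    exact .inl ⟨[], [], rfl, nil, nil⟩
  | @cons a u v h ih =>
    rcases List.append_eq_cons_iff.1 hu with ⟨rfl, rfl⟩ | ⟨t, rfl, rfl⟩
    · exact .inl ⟨[], _, rfl, nil, cons a h⟩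
    · rcases ih rfl with ⟨w₁, w₂, rfl, h₁, h₂⟩ | ⟨p, q, r, s, w₁, w₂, rfl, rfl, h₁, h₂, rfl⟩
      · exact .inl ⟨a :: w₁, w₂, rfl, cons a h₁, h₂⟩
      · exact .inr ⟨a :: p, q, r, s, a :: w₁, w₂, rfl, rfl, cons a h₁, h₂, rfl⟩
  | @dup b u v h ih =>
    rcases List.append_eq_append_iff.1 hu with ⟨t, rfl, rfl⟩ | ⟨t, rfl, rfl⟩
    · exact .inr ⟨[], u₁, t, u, [], v, rfl, rfl, nil, h, by simp⟩
    · rcases ih rfl with ⟨w₁, w₂, rfl, h₁, h₂⟩ | ⟨p, q, r, s, w₁, w₂, rfl, rfl, h₁, h₂, rfl⟩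
      · exact .inl ⟨b ++ b ++ w₁, w₂, by simp, dup b h₁, h₂⟩
      · exact .inr ⟨b ++ p, q, r, s, b ++ b ++ w₁, w₂, by simp, rfl, dup b h₁, h₂, by simp⟩

end ParDup

namespace SqDup

variable {α β : Type*}

theorem mk (x y z : List α) : SqDup (x ++ y ++ z) (x ++ y ++ y ++ z) :=
  ⟨x, y, z, rfl, rfl⟩

theorem parDup {u v : List α} (h : SqDup u v) : ParDup u v := by
  obtain ⟨x, y, z, rfl, rfl⟩ := h
  simpa using ((ParDup.refl x).append (ParDup.double y)).append (ParDup.refl z)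

theorem cons {u v : List α} (a : α) (h : SqDup u v) : SqDup (a :: u) (a :: v) := by
  obtain ⟨x, y, z, rfl, rfl⟩ := h
  exact mk (a :: x) y z

theorem reflTransGen_append_left {u v : List α} (b : List α) (h : ReflTransGen SqDup u v) :
    ReflTransGen SqDup (b ++ u) (b ++ v) := by
  induction b with
  | nil => exact h
  | cons a b ih => exact ih.lift (a :: ·) fun _ _ => cons a

theorem reflTransGen_of_parDup {u v : List α} (h : ParDup u v) : ReflTransGen SqDup u v := by
  induction h with
  | nil => exact .refl
  | cons a _ ih => exact ih.lift (a :: ·) fun _ _ => cons a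
  | dup b _ ih => exact (reflTransGen_append_left b ih).tail (by simpa using mk [] b _)

/-- A single duplication commutes with a parallel one. -/
theorem parDup_strip {u v w : List α} (h : SqDup u v) (hw : ParDup u w) :
    ∃ x, ParDup v x ∧ ReflTransGen SqDup w x := by
  obtain ⟨a, b, c, rfl, rfl⟩ := h
  rw [List.append_assoc] at hw
  rcases hw.split with ⟨wa, w', rfl, ha, hw'⟩ | ⟨p, q, r, s, w₁, w₂, rfl, hs, hp, hw₂, rfl⟩
  · rcases hw'.split with ⟨wb, wc, rfl, hb, hc⟩ | ⟨p, q, r, s, w₁, w₂, rfl, rfl, hp, hs, rfl⟩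
    · exact ⟨_, ((ha.append hb).append hb).append hc, .single (by simpa using mk wa wb wc)⟩
    · refine ⟨wa ++ (w₁ ++ q) ++ (w₁ ++ q) ++ (r ++ q ++ r ++ w₂), ?_,
        .single (by simpa using mk wa (w₁ ++ q) (r ++ q ++ r ++ w₂))⟩
      simpa using ((ha.append (hp.append (ParDup.refl q))).append hp).append
        ((ParDup.double (q ++ r)).append hs)
  · rcases List.append_eq_append_iff.1 hs with ⟨t, rfl, rfl⟩ | ⟨t, rfl, rfl⟩
    · refine ⟨w₁ ++ (q ++ b ++ b ++ t) ++ (q ++ b ++ b ++ t) ++ w₂, ?_, ?_⟩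
      · simpa using (hp.append (ParDup.double (q ++ b ++ b ++ t))).append hw₂
      · have h₁ := mk (w₁ ++ q) b (t ++ q ++ b ++ t ++ w₂)
        have h₂ := mk (w₁ ++ q ++ b ++ b ++ t ++ q) b (t ++ w₂)
        simp only [List.append_assoc] at h₁ h₂ ⊢
        exact .tail (.single h₁) h₂
    · rcases hw₂.split with ⟨wb, wc, rfl, hb, hc⟩ |
        ⟨p', q', r', s', w₃, w₄, rfl, rfl, hp', hs', rfl⟩
      · refine ⟨w₁ ++ q ++ r ++ q ++ (r ++ wb) ++ (r ++ wb) ++ wc, ?_,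
          .single (by simpa using mk (w₁ ++ q ++ r ++ q) (r ++ wb) wc)⟩
        simpa using ((hp.append (ParDup.double (q ++ r))).append hb).append
          (((ParDup.refl r).append hb).append hc)
      · refine ⟨w₁ ++ q ++ r ++ q ++ (r ++ w₃ ++ q') ++ (r ++ w₃ ++ q') ++ (r' ++ q' ++ r' ++ w₄),
          ?_, .single (by
            simpa using mk (w₁ ++ q ++ r ++ q) (r ++ w₃ ++ q') (r' ++ q' ++ r' ++ w₄))⟩
        simpa using ((hp.append (ParDup.double (q ++ r))).append
          (hp'.append (ParDup.refl q'))).append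
          ((((ParDup.refl r).append hp').append (ParDup.double (q' ++ r'))).append hs')

theorem reflTransGen_parDup_strip {u v w : List α} (h : ReflTransGen SqDup u v)
    (hw : ParDup u w) : ∃ x, ParDup v x ∧ ReflTransGen SqDup w x := by
  induction h with
  | refl => exact ⟨w, hw, .refl⟩
  | tail _ hbc ih =>
    obtain ⟨x, hx, hwx⟩ := ih
    obtain ⟨y, hy, hxy⟩ := hbc.parDup_strip hx
    exact ⟨y, hy, hwx.trans hxy⟩

theorem confluent {u v w : List α} (h : ReflTransGen SqDup u v) (hw : ReflTransGen SqDup u w) :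
    Join (ReflTransGen SqDup) v w := by
  induction hw with
  | refl => exact ⟨v, .refl, h⟩
  | tail _ hbc ih =>
    obtain ⟨x, hvx, hbx⟩ := ih
    obtain ⟨y, hxy, hcy⟩ := reflTransGen_parDup_strip hbx hbc.parDup
    exact ⟨y, hvx.trans (reflTransGen_of_parDup hxy), hcy⟩

theorem join_of_eqvGen {u v : List α} (h : EqvGen SqDup u v) :
    Join (ReflTransGen SqDup) u v := by
  induction h with
  | rel _ y h => exact ⟨y, .single h, .refl⟩
  | refl x => exact ⟨x, .refl, .refl⟩
  | symm _ _ _ ih =>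
    obtain ⟨a, hxa, hya⟩ := ih
    exact ⟨a, hya, hxa⟩
  | trans _ _ _ _ _ ih₁ ih₂ =>
    obtain ⟨a, hxa, hya⟩ := ih₁
    obtain ⟨b, hyb, hzb⟩ := ih₂
    obtain ⟨c, hac, hbc⟩ := confluent hya hyb
    exact ⟨c, hxa.trans hac, hzb.trans hbc⟩

theorem lift_forall₂ {R : α → β → Prop} {l : List α} {u v : List β} (hl : List.Forall₂ R l u)
    (h : SqDup u v) : ∃ l', SqDup l l' ∧ List.Forall₂ R l' v := by
  obtain ⟨x, y, z, rfl, rfl⟩ := h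
  have hz := List.forall₂_drop_append _ _ _ hl
  have hxy := List.forall₂_take_append _ _ _ hl
  have hx := List.forall₂_take_append _ _ _ hxy
  have hy := List.forall₂_drop_append _ _ _ hxy
  refine ⟨_, ⟨_, _, _, ?_, rfl⟩, List.rel_append (List.rel_append (List.rel_append hx hy) hy) hz⟩
  simp only [List.take_append_drop]

theorem lift_forall₂_reflTransGen {R : α → β → Prop} {l : List α} {u v : List β}
    (hl : List.Forall₂ R l u) (h : ReflTransGen SqDup u v) :
    ∃ l', EqvGen SqDup l l' ∧ List.Forall₂ R l' v := by
  induction h with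
  | refl => exact ⟨l, .refl l, hl⟩
  | tail _ h ih =>
    obtain ⟨l', hll', hl'⟩ := ih
    obtain ⟨l'', h', hl''⟩ := lift_forall₂ hl' h
    exact ⟨l'', hll'.trans _ _ _ (.rel _ _ h'), hl''⟩

end SqDup

theorem List.Forall₂.comp {α β γ : Type*} {S : α → β → Prop} {T : β → γ → Prop}
    {l₁ : List α} {l₂ : List β} {l₃ : List γ} (h : List.Forall₂ S l₁ l₂)
    (h' : List.Forall₂ T l₂ l₃) : List.Forall₂ (Comp S T) l₁ l₃ := by
  induction h generalizing l₃ with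
  | nil => cases h'; exact .nil
  | cons hab _ ih => cases h' with | cons hbc h' => exact .cons ⟨_, hab, hbc⟩ (ih h')

/-- Subdistributivity of the relator for the free idempotent monoid. -/
theorem fim_subdistributivity {α β γ : Type*}
    (S : α → β → Prop) (T : β → γ → Prop)
    (hne : ∃ a c, Comp S T a c)
    (xs : List α) (us vs : List β) (zs : List γ)
    (hxu : List.Forall₂ S xs us)
    (huv : Relation.EqvGen SqDup us vs)
    (hvz : List.Forall₂ T vs zs) :
    ∃ (xs' : List α) (zs' : List γ),
      Relation.EqvGen SqDup xs xs' ∧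
      List.Forall₂ (Comp S T) xs' zs' ∧
      Relation.EqvGen SqDup zs' zs := by
  obtain ⟨ws, huw, hvw⟩ := SqDup.join_of_eqvGen huv
  obtain ⟨xs', hx, hxw⟩ := SqDup.lift_forall₂_reflTransGen hxu huw
  obtain ⟨zs', hz, hzw⟩ := SqDup.lift_forall₂_reflTransGen hvz.flip hvw
  exact ⟨xs', zs', hx, hxw.comp hzw.flip, hz.symm _ _⟩
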